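/- arXiv:1811.07076 — 3 statements merged into one kernel-verified Lean document; each statement's English description precedes it below -/
import Mathlib

section
/- Let ∂Δ^m be the boundary of the m-simplex, i.e., the abstract simplicial complex on Fin (m+1) consisting of all finsets σ ≠ Finset.univ. With X = Metric.closedBall (0 : ℂ) 1 (the closed unit disc D²) and A = {z ∈ X | ‖z‖ = 1} (the unit circle S¹), the polyhedral product Z(∂Δ^m;(D²,S¹)) is homeomorphic to the (2m+1)-sphere, i.e., to the unit sphere Metric.sphere (0 : EuclideanSpace ℂ (Fin (m+1))) 1. -/
open Classical

/-- `D² = ` the closed unit disc in `ℂ`, with the subspace topology. -/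
abbrev D2 : Type := Metric.closedBall (0 : ℂ) 1

/-- `S¹ = ` the unit circle, as a subset of `D²`. -/
def S1 : Set D2 := {z : D2 | ‖(z : ℂ)‖ = 1}

/-- The boundary `∂Δ^m` of the `m`-simplex: all finsets of `Fin (m+1)` except `univ`. -/
def simplexBoundary (m : ℕ) : Set (Finset (Fin (m + 1))) :=
  {σ : Finset (Fin (m + 1)) | σ ≠ Finset.univ}

/-- A continuous linear equivalence of real normed spaces induces a homeomorphism of the unit
spheres by radial projection. -/
noncomputable def ContinuousLinearEquiv.unitSphereHomeomorph {E F : Type*}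
    [NormedAddCommGroup E] [NormedSpace ℝ E] [NormedAddCommGroup F] [NormedSpace ℝ F]
    (e : E ≃L[ℝ] F) : Metric.sphere (0 : E) 1 ≃ₜ Metric.sphere (0 : F) 1 where
  toFun x := ⟨‖e x‖⁻¹ • e x, by
    have hx : e x ≠ 0 := e.map_ne_zero_iff.2 (ne_zero_of_mem_unit_sphere x)
    simp [norm_smul, hx]⟩
  invFun y := ⟨‖e.symm y‖⁻¹ • e.symm y, by
    have hy : e.symm y ≠ 0 := e.symm.map_ne_zero_iff.2 (ne_zero_of_mem_unit_sphere y)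
    simp [norm_smul, hy]⟩
  left_inv x := by
    have hx : e x ≠ 0 := e.map_ne_zero_iff.2 (ne_zero_of_mem_unit_sphere x)
    ext1
    simp [norm_smul, smul_smul, hx]
  right_inv y := by
    have hy : e.symm y ≠ 0 := e.symm.map_ne_zero_iff.2 (ne_zero_of_mem_unit_sphere y)
    ext1
    simp [norm_smul, smul_smul, hy]
  continuous_toFun := by
    have h : Continuous fun x : Metric.sphere (0 : E) 1 => e x :=
      e.continuous.comp continuous_subtype_val
    exact ((h.norm.inv₀ fun x => norm_ne_zero_iff.2
      (e.map_ne_zero_iff.2 (ne_zero_of_mem_unit_sphere x))).smul h).subtype_mk _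
  continuous_invFun := by
    have h : Continuous fun y : Metric.sphere (0 : F) 1 => e.symm y :=
      e.symm.continuous.comp continuous_subtype_val
    exact ((h.norm.inv₀ fun y => norm_ne_zero_iff.2
      (e.symm.map_ne_zero_iff.2 (ne_zero_of_mem_unit_sphere y))).smul h).subtype_mk _

/-- A point of `(D²)^(m+1)` lies in the moment-angle complex of `∂Δ^m` iff some coordinate
lies on the unit circle. -/
theorem filter_notMem_S1_mem_simplexBoundary_iff {m : ℕ} (f : Fin (m + 1) → D2) :
    Finset.filter (fun i => f i ∉ S1) Finset.univ ∈ simplexBoundary m ↔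
      ∃ i, ‖(f i : ℂ)‖ = 1 := by
  rw [simplexBoundary, Set.mem_ofPred_eq, Ne, Finset.filter_eq_self]
  simp [S1]

/-- A vector has sup norm one iff all its coordinates have norm at most one, with equality for
some coordinate. -/
theorem pi_norm_eq_one_iff {ι E : Type*} [Fintype ι] [SeminormedAddCommGroup E]
    (x : ι → E) : ‖x‖ = 1 ↔ (∀ i, ‖x i‖ ≤ 1) ∧ ∃ i, ‖x i‖ = 1 := by
  constructor
  · intro h
    have hle : ∀ i, ‖x i‖ ≤ 1 := fun i => h ▸ norm_le_pi_norm x i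
    refine ⟨hle, ?_⟩
    by_contra! hne
    exact ((pi_norm_lt_iff zero_lt_one).2 fun i => lt_of_le_of_ne (hle i) (hne i)).ne h
  · rintro ⟨h, i, hi⟩
    exact le_antisymm ((pi_norm_le_iff_of_nonneg zero_le_one).2 h) (hi ▸ norm_le_pi_norm x i)

/-- The moment-angle complex of `∂Δ^m` is the unit sphere of `ℂ^(m+1)` for the sup norm. -/
noncomputable def momentAngleHomeomorphSupSphere (m : ℕ) :
    {f : Fin (m + 1) → D2 //
        Finset.filter (fun i => f i ∉ S1) Finset.univ ∈ simplexBoundary m} ≃ₜ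
      Metric.sphere (0 : Fin (m + 1) → ℂ) 1 where
  toFun f := ⟨fun i => f.1 i, mem_sphere_zero_iff_norm.2 <| (pi_norm_eq_one_iff _).2
    ⟨fun i => mem_closedBall_zero_iff.1 (f.1 i).2,
      (filter_notMem_S1_mem_simplexBoundary_iff f.1).1 f.2⟩⟩
  invFun x := ⟨fun i => ⟨x.1 i, mem_closedBall_zero_iff.2
      (((pi_norm_eq_one_iff _).1 (mem_sphere_zero_iff_norm.1 x.2)).1 i)⟩,
    (filter_notMem_S1_mem_simplexBoundary_iff _).2
      ((pi_norm_eq_one_iff _).1 (mem_sphere_zero_iff_norm.1 x.2)).2⟩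
  left_inv _ := rfl
  right_inv _ := rfl
  continuous_toFun := (continuous_pi fun i => continuous_subtype_val.comp
    ((continuous_apply i).comp continuous_subtype_val)).subtype_mk _
  continuous_invFun := (continuous_pi fun i =>
    ((continuous_apply i).comp continuous_subtype_val).subtype_mk _).subtype_mk _

/-- The moment-angle complex `Z(∂Δ^m;(D²,S¹))` is homeomorphic to the `(2m+1)`-sphere,
realized as the unit sphere in `EuclideanSpace ℂ (Fin (m+1))`. -/
theorem momentAngle_simplexBoundary_homeomorph_sphere (m : ℕ) :
    Nonempty (
      {f : Fin (m + 1) → D2 //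
          Finset.filter (fun i => f i ∉ S1) Finset.univ ∈ simplexBoundary m} ≃ₜ
      Metric.sphere (0 : EuclideanSpace ℂ (Fin (m + 1))) 1) := by
  exact ⟨(momentAngleHomeomorphSupSphere m).trans
    (PiLp.continuousLinearEquiv 2 ℝ fun _ : Fin (m + 1) => ℂ).symm.unitSphereHomeomorph⟩
end

section
/- Let K be an abstract simplicial complex on the vertex set Fin m, let X be a topological space, A ⊆ X a subset, and let G be a subgroup of Equiv.Perm (Fin m) acting on K. Suppose h : V_G → X satisfies that the union of the finsets in {v ∈ V_G | h v ∉ A} belongs to K (i.e., h determines a point of Z(K//G;(X,A))), and suppose a assigns to each G-orbit finset not belonging to K an element of A. Define f : Fin m → X by f i = h v if the G-orbit finset v of i belongs to K, and f i = a v if the G-orbit finset v of i does not belong to K. Then f belongs to Z(K;(X,A)) and f is fixed by every element of G. -/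
open Classical

/-- The orbit of `i` under a subgroup `G ≤ Perm (Fin m)`, regarded as a finset of `Fin m`. -/
noncomputable def orbitFinset {m : ℕ} (G : Subgroup (Equiv.Perm (Fin m))) (i : Fin m) :
    Finset (Fin m) :=
  Finset.filter (fun j => ∃ g ∈ G, g i = j) Finset.univ

lemma self_mem_orbitFinset {m : ℕ} (G : Subgroup (Equiv.Perm (Fin m))) (i : Fin m) :
    i ∈ orbitFinset G i :=
  Finset.mem_filter.2 ⟨Finset.mem_univ i, 1, G.one_mem, rfl⟩

lemma orbitFinset_apply_of_mem {m : ℕ} {G : Subgroup (Equiv.Perm (Fin m))}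
    {g : Equiv.Perm (Fin m)} (hg : g ∈ G) (i : Fin m) :
    orbitFinset G (g i) = orbitFinset G i := by
  ext j
  simp only [orbitFinset, Finset.mem_filter, Finset.mem_univ, true_and]
  constructor
  · rintro ⟨k, hk, rfl⟩
    exact ⟨k * g, G.mul_mem hk hg, rfl⟩
  · rintro ⟨k, hk, rfl⟩
    exact ⟨k * g⁻¹, G.mul_mem hk (G.inv_mem hg), by simp⟩

/-- Given a point `h` of `Z(K//G;(X,A))` (a function on the vertex set `V_G` of orbit
finsets belonging to `K`, such that the union of the finsets where `h` leaves `A` belongs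
to `K`) and a choice `a` of an element of `A` for each orbit finset not belonging to `K`,
the function `f` defined by `f i = h (orbit of i)` if that orbit belongs to `K` and
`f i = a (orbit of i)` otherwise belongs to `Z(K;(X,A))` and is fixed by every element
of `G`. -/
theorem glued_function_mem_and_fixed {m : ℕ} (K : Set (Finset (Fin m)))
    (hK : ∀ σ ∈ K, ∀ τ ⊆ σ, τ ∈ K) (hKempty : (∅ : Finset (Fin m)) ∈ K)
    {X : Type*} [TopologicalSpace X] (A : Set X)
    (G : Subgroup (Equiv.Perm (Fin m)))
    (hG : ∀ g ∈ G, ∀ σ ∈ K, σ.image g ∈ K)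
    (h : {v : Finset (Fin m) // (∃ i, v = orbitFinset G i) ∧ v ∈ K} → X)
    (hh : Finset.filter
        (fun i => ∃ v : {v : Finset (Fin m) // (∃ i, v = orbitFinset G i) ∧ v ∈ K},
          i ∈ v.1 ∧ h v ∉ A) Finset.univ ∈ K)
    (a : {v : Finset (Fin m) // (∃ i, v = orbitFinset G i) ∧ v ∉ K} → X)
    (ha : ∀ v, a v ∈ A)
    (f : Fin m → X)
    (hf1 : ∀ (i : Fin m) (hi : orbitFinset G i ∈ K),
      f i = h ⟨orbitFinset G i, ⟨i, rfl⟩, hi⟩)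
    (hf2 : ∀ (i : Fin m) (hi : orbitFinset G i ∉ K),
      f i = a ⟨orbitFinset G i, ⟨i, rfl⟩, hi⟩) :
    Finset.filter (fun i => f i ∉ A) Finset.univ ∈ K ∧
      ∀ g ∈ G, ∀ i : Fin m, f (g⁻¹ i) = f i := by
  refine ⟨hK _ hh _ fun i hi => ?_, fun g hg i => ?_⟩
  · simp only [Finset.mem_filter, Finset.mem_univ, true_and] at hi ⊢
    by_cases hiK : orbitFinset G i ∈ K
    · exact ⟨⟨orbitFinset G i, ⟨i, rfl⟩, hiK⟩, self_mem_orbitFinset G i, hf1 i hiK ▸ hi⟩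
    · exact absurd (hf2 i hiK ▸ ha _) hi
  · have horb := orbitFinset_apply_of_mem (G.inv_mem hg) i
    by_cases hiK : orbitFinset G i ∈ K
    · rw [hf1 i hiK, hf1 _ (horb ▸ hiK)]
      exact congrArg h (Subtype.ext horb)
    · rw [hf2 i hiK, hf2 _ (horb ▸ hiK)]
      exact congrArg a (Subtype.ext horb)
end

section
/- Let K be an abstract simplicial complex on the vertex set Fin m, let X be a topological space, A ⊆ X a subset, and let G be a subgroup of Equiv.Perm (Fin m) acting on K. If f ∈ Z(K;(X,A)) is fixed by every element of G, then the set S = {v ∈ V_G | ∃ i ∈ v, f i ∉ A} of orbit finsets belonging to K on which f takes a value outside A satisfies: the union of the finsets in S belongs to K. In other words, S is a face of the strong quotient K//G, so a G-fixed point of Z(K;(X,A)) determines a point of Z(K//G;(X,A)). -/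
open Classical

/-- A function invariant under `G` is constant on the orbits of `G`. -/
theorem apply_eq_of_mem_orbitFinset {m : ℕ} {G : Subgroup (Equiv.Perm (Fin m))} {X : Type*}
    {f : Fin m → X} (hfix : ∀ g ∈ G, ∀ i : Fin m, f (g⁻¹ i) = f i) {i j : Fin m}
    (hi : i ∈ orbitFinset G j) : f i = f j := by
  obtain ⟨g, hg, rfl⟩ := (Finset.mem_filter.mp hi).2
  simpa using (hfix g hg (g j)).symm

/-- If `f ∈ Z(K;(X,A))` is fixed by every element of `G`, then the set `S` of orbit finsets
belonging to `K` on which `f` takes a value outside `A` has its union in `K`; i.e. `S` is a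
face of the strong quotient `K//G`, so a `G`-fixed point of `Z(K;(X,A))` determines a point
of `Z(K//G;(X,A))`. -/
theorem fixedPoint_determines_strongQuotient_point {m : ℕ} (K : Set (Finset (Fin m)))
    (hK : ∀ σ ∈ K, ∀ τ ⊆ σ, τ ∈ K) (hKempty : (∅ : Finset (Fin m)) ∈ K)
    {X : Type*} [TopologicalSpace X] (A : Set X)
    (G : Subgroup (Equiv.Perm (Fin m)))
    (hG : ∀ g ∈ G, ∀ σ ∈ K, σ.image g ∈ K)
    (f : Fin m → X)
    (hf : Finset.filter (fun i => f i ∉ A) Finset.univ ∈ K)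
    (hfix : ∀ g ∈ G, ∀ i : Fin m, f (g⁻¹ i) = f i) :
    Finset.filter
      (fun i => ∃ v : {v : Finset (Fin m) // (∃ j, v = orbitFinset G j) ∧ v ∈ K},
        (∃ j ∈ v.1, f j ∉ A) ∧ i ∈ v.1) Finset.univ ∈ K := by
  refine hK _ hf _ fun i hi => ?_
  simp only [Finset.mem_filter, Finset.mem_univ, true_and] at hi ⊢
  obtain ⟨⟨_, ⟨j, rfl⟩, _⟩, ⟨k, hk, hkA⟩, hi⟩ := hi
  rwa [apply_eq_of_mem_orbitFinset hfix hi, ← apply_eq_of_mem_orbitFinset hfix hk]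
end
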